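/- Under the same setting, if γ = α(v − f) + r with α ∈ (0,1], then u(f) − u(f+γ) ≤ 2(‖γ‖_2 + ‖r‖_2/α), since the ℓ∞ norm is bounded by the ℓ2 norm. -/

import Mathlib

theorem abs_expect_le_l2 {m : ℕ} (q x : Fin m → ℝ) (hq : ∀ o, 0 ≤ q o)
    (hq1 : ∑ o, q o = 1) : |∑ o, q o * x o| ≤ Real.sqrt (∑ o, x o ^ 2) := by
  have key : ∀ o, |x o| ≤ Real.sqrt (∑ o, x o ^ 2) := fun o =>
    Real.abs_le_sqrt (Finset.single_le_sum (f := fun o => x o ^ 2)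
      (fun i _ => sq_nonneg (x i)) (Finset.mem_univ o))
  calc |∑ o, q o * x o| ≤ ∑ o, |q o * x o| := Finset.abs_sum_le_sum_abs _ _
    _ ≤ ∑ o, q o * Real.sqrt (∑ o, x o ^ 2) := by
        refine Finset.sum_le_sum fun o _ => ?_
        rw [abs_mul, abs_of_nonneg (hq o)]
        exact mul_le_mul_of_nonneg_left (key o) (hq o)
    _ = Real.sqrt (∑ o, x o ^ 2) := by rw [← Finset.sum_mul, hq1, one_mul]


/-- Continuity of the utility function, ℓ2 version:
if γ = α(v − f) + r with α ∈ (0,1], then u(f) − u(f+γ) ≤ 2(‖γ‖_2 + ‖r‖_2/α). -/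
theorem utility_continuity_l2_norm
    {m : ℕ} {A : Type*} [Nonempty A]
    (p : A → Fin m → ℝ) (c : A → ℝ) (astar : (Fin m → ℝ) → A)
    (hp : ∀ a o, 0 ≤ p a o) (hp1 : ∀ a, ∑ o, p a o = 1)
    (hbr : ∀ (f : Fin m → ℝ) (a : A),
      ∑ o, p a o * f o - c a ≤ ∑ o, p (astar f) o * f o - c (astar f))
    (v : Fin m → ℝ) (hv : ∀ o, v o ∈ Set.Icc (0:ℝ) 1)
    (u : (Fin m → ℝ) → ℝ)
    (hu : ∀ f, u f = ∑ o, p (astar f) o * (v o - f o))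
    (f γ r : Fin m → ℝ) (α : ℝ) (hα0 : 0 < α) (hα1 : α ≤ 1)
    (hγ : γ = α • (v - f) + r)
    (hf : ∀ o, f o ∈ Set.Icc (0:ℝ) 1)
    (hfγ : ∀ o, f o + γ o ∈ Set.Icc (0:ℝ) 1) :
    u f - u (f + γ) ≤
      2 * (Real.sqrt (∑ o, γ o ^ 2) + Real.sqrt (∑ o, r o ^ 2) / α) := by
  have h1 := hbr f (astar (f + γ))
  have h2 := hbr (f + γ) (astar f)
  rw [hu, hu]
  generalize astar (f + γ) = b at *
  generalize astar f = a at *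
  have e : ∀ d, ∑ o, p d o * (f + γ) o = ∑ o, p d o * f o + ∑ o, p d o * γ o := by
    intro d
    rw [← Finset.sum_add_distrib]
    exact Finset.sum_congr rfl fun o _ => by simp [mul_add]
  have e2 : ∀ d, ∑ o, p d o * γ o
      = α * ∑ o, p d o * (v o - f o) + ∑ o, p d o * r o := by
    intro d
    rw [Finset.mul_sum, ← Finset.sum_add_distrib]
    refine Finset.sum_congr rfl fun o _ => ?_
    rw [hγ]
    simp only [Pi.add_apply, Pi.smul_apply, Pi.sub_apply, smul_eq_mul]
    ring
  have e3 : ∑ o, p b o * (v o - (f + γ) o)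
      = ∑ o, p b o * (v o - f o) - ∑ o, p b o * γ o := by
    rw [← Finset.sum_sub_distrib]
    refine Finset.sum_congr rfl fun o _ => ?_
    simp only [Pi.add_apply]
    ring
  rw [e, e] at h2
  rw [e3]
  have hb := abs_le.mp (abs_expect_le_l2 (p b) r (hp b) (hp1 b))
  have ha := abs_le.mp (abs_expect_le_l2 (p a) r (hp a) (hp1 a))
  have hg := abs_le.mp (abs_expect_le_l2 (p b) γ (hp b) (hp1 b))
  have hG := Real.sqrt_nonneg (∑ o, γ o ^ 2)
  have h3 : ∑ o, p a o * γ o ≤ ∑ o, p b o * γ o := by linarith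
  rw [e2 a, e2 b] at h3
  have h4 : ∑ o, p a o * (v o - f o) - ∑ o, p b o * (v o - f o)
      ≤ 2 * Real.sqrt (∑ o, r o ^ 2) / α := by
    rw [le_div_iff₀ hα0]
    linarith [hb.2, ha.1]
  rw [mul_div_assoc] at h4
  linarith [hg.2]
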